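/- The point (1/2, 0) satisfies 16X⁴ + 32X²Y² + 16Y⁴ - 72X² - 72Y² + 64X - 15 = 0, and it is an isolated point of the real zero set: there exists ε > 0 such that no other real solution (X,Y) of this equation lies within distance ε of (1/2, 0). -/

import Mathlib

theorem isolated_point_of_quartic :
    (16 * (1 / 2 : ℝ) ^ 4 + 32 * (1 / 2 : ℝ) ^ 2 * (0 : ℝ) ^ 2 + 16 * (0 : ℝ) ^ 4
        - 72 * (1 / 2 : ℝ) ^ 2 - 72 * (0 : ℝ) ^ 2 + 64 * (1 / 2 : ℝ) - 15 = 0) ∧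
    ∃ ε > (0 : ℝ), ∀ X Y : ℝ,
      16 * X ^ 4 + 32 * X ^ 2 * Y ^ 2 + 16 * Y ^ 4
          - 72 * X ^ 2 - 72 * Y ^ 2 + 64 * X - 15 = 0 →
      (X - 1 / 2) ^ 2 + Y ^ 2 < ε ^ 2 →
      X = 1 / 2 ∧ Y = 0 := by
  refine ⟨by norm_num, 1 / 2, by norm_num, fun X Y h hlt => ?_⟩
  obtain ⟨x, rfl⟩ : ∃ x, X = x + 1 / 2 := ⟨X - 1 / 2, by ring⟩
  obtain ⟨s, hs⟩ : ∃ s, s = x ^ 2 + Y ^ 2 := ⟨_, rfl⟩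
  have hs_lt : s < 1 / 4 := by rw [hs]; linarith
  have hx : x ^ 2 ≤ s := by rw [hs]; linarith [sq_nonneg Y]
  have hs_nonneg : 0 ≤ s := (sq_nonneg x).trans hx
  have key : (s + x) ^ 2 = 4 * s := by rw [hs]; linear_combination h / 16
  have hs_zero : s = 0 := by
    nlinarith [sq_nonneg (s - x), mul_nonneg hs_nonneg (sub_nonneg.2 hs_lt.le)]
  have hx_zero : x = 0 := pow_eq_zero_iff two_ne_zero |>.1 (by linarith [sq_nonneg x])
  have hY_zero : Y = 0 := pow_eq_zero_iff two_ne_zero |>.1 (by linarith [sq_nonneg x, sq_nonneg Y])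
  exact ⟨by rw [hx_zero]; norm_num, hY_zero⟩
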